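/- arXiv:2204.13882 — 5 statements merged into one kernel-verified Lean document; each statement's English description precedes it below -/
import Mathlib

section
/- For every integer n₀ > 1, the total number p(n₀) of partitions of n₀ satisfies p(n₀) > exp(2.5·√n₀) / (13·n₀). -/
theorem hasSum_sq_mul_geometric {q : ℝ} (h0 : 0 ≤ q) (h1 : q < 1) :
    HasSum (fun m : ℕ => (m : ℝ) ^ 2 * q ^ m) (q * (1 + q) / (1 - q) ^ 3) := by
  have hq : ‖q‖ < 1 := by rwa [Real.norm_of_nonneg h0]
  have hne : 1 - q ≠ 0 := by linarith
  convert! ((hasSum_choose_mul_geometric_of_norm_lt_one 2 hq).mul_left 2).sub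
    (((hasSum_coe_mul_geometric_of_norm_lt_one hq).mul_left 3).add
      ((hasSum_geometric_of_norm_lt_one hq).mul_left 2)) using 1
  · funext m
    rw [Nat.cast_choose_two]
    push_cast
    ring
  · field_simp
    ring

theorem hasSum_cube_mul_geometric {q : ℝ} (h0 : 0 ≤ q) (h1 : q < 1) :
    HasSum (fun m : ℕ => (m : ℝ) ^ 3 * q ^ m) (q * (1 + 4 * q + q ^ 2) / (1 - q) ^ 4) := by
  have hq : ‖q‖ < 1 := by rwa [Real.norm_of_nonneg h0]
  have hne : 1 - q ≠ 0 := by linarith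
  convert! ((hasSum_choose_mul_geometric_of_norm_lt_one 3 hq).mul_left 6).sub
    (((hasSum_sq_mul_geometric h0 h1).mul_left 6).add
      (((hasSum_coe_mul_geometric_of_norm_lt_one hq).mul_left 11).add
        ((hasSum_geometric_of_norm_lt_one hq).mul_left 6))) using 1
  · funext m
    have h : 6 * ((m + 3).choose 3 : ℝ) = (m + 3) * (m + 2) * (m + 1) := by
      have := Nat.descFactorial_eq_factorial_mul_choose (m + 3) 3
      simp only [Nat.descFactorial, Nat.factorial] at this
      have h' : 6 * (m + 3).choose 3 = (m + 3) * (m + 2) * (m + 1) := by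
        norm_num at this
        rw [← this, show m + 3 - 2 = m + 1 by omega]
        ring
      exact_mod_cast h'
    linear_combination (-q ^ m) * h
  · field_simp
    ring

theorem exp_neg_eq_sinh_quotients {z : ℝ} (hz : 0 < z) :
    Real.exp (-(2 * z)) / (1 - Real.exp (-(2 * z))) ^ 2 = 1 / (4 * Real.sinh z ^ 2) ∧
    Real.exp (-(2 * z)) * (1 + Real.exp (-(2 * z))) / (1 - Real.exp (-(2 * z))) ^ 3 =
      Real.cosh z / (4 * Real.sinh z ^ 3) ∧
    Real.exp (-(2 * z)) * (1 + 4 * Real.exp (-(2 * z)) + Real.exp (-(2 * z)) ^ 2) /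
        (1 - Real.exp (-(2 * z))) ^ 4 =
      (3 + 2 * Real.sinh z ^ 2) / (8 * Real.sinh z ^ 4) := by
  have he : Real.exp (-(2 * z)) = Real.exp (-z) ^ 2 := by rw [← Real.exp_nat_mul]; ring_nf
  have hinv : Real.exp z = (Real.exp (-z))⁻¹ := by rw [Real.exp_neg, inv_inv]
  have hpos := Real.exp_pos (-z)
  have hlt : Real.exp (-z) < 1 := Real.exp_lt_one_iff.2 (by linarith)
  rw [he, Real.sinh_eq, Real.cosh_eq, hinv]
  generalize Real.exp (-z) = e at *
  have h1 : 1 - e ^ 2 ≠ 0 := by nlinarith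
  have h2 : e⁻¹ - e = (1 - e ^ 2) / e := by field_simp
  rw [h2]
  refine ⟨?_, ?_, ?_⟩ <;> field_simp <;> ring

theorem sinh_mul_le_self {z : ℝ} (h0 : 0 ≤ z) (h1 : z ≤ 1) :
    Real.sinh z * (1 - z ^ 2 / 6) ≤ z := by
  have hz : z ^ 2 / 6 < 1 := by nlinarith
  have hpos : 0 < 1 - z ^ 2 / 6 := by linarith
  rw [← le_div_iff₀ hpos, div_eq_mul_inv]
  refine hasSum_le (fun n => ?_) (Real.hasSum_sinh z)
    ((hasSum_geometric_of_lt_one (by positivity) hz).mul_left z)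
  rw [div_pow, pow_succ, pow_mul, mul_comm, ← mul_div_assoc]
  have : (6 : ℝ) ^ n ≤ ((2 * n + 1).factorial : ℝ) := by
    norm_cast
    induction n with
    | zero => simp
    | succ n ih =>
      rw [show 2 * (n + 1) + 1 = 2 * n + 1 + 1 + 1 by ring, Nat.factorial_succ, Nat.factorial_succ,
        pow_succ]
      have := (2 * n + 1).factorial_pos
      have h6 : 6 ≤ (2 * n + 1 + 1 + 1) * (2 * n + 1 + 1) := by nlinarith
      calc 6 ^ n * 6 ≤ (2 * n + 1).factorial * ((2 * n + 1 + 1 + 1) * (2 * n + 1 + 1)) :=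
            Nat.mul_le_mul ih h6
        _ = _ := by ring
  gcongr

theorem one_div_four_mul_sinh_sq_ge {z : ℝ} (h0 : 0 < z) (h1 : z ≤ 1) :
    1 / (4 * z ^ 2) - 1 / 12 ≤ 1 / (4 * Real.sinh z ^ 2) := by
  have hS : 0 < Real.sinh z := Real.sinh_pos_iff.2 h0
  have h := sinh_mul_le_self h0.le h1
  have hz : 0 < 1 - z ^ 2 / 6 := by nlinarith
  have h2 : (Real.sinh z * (1 - z ^ 2 / 6)) ^ 2 ≤ z ^ 2 := by gcongr
  rw [show 1 / (4 * z ^ 2) - 1 / 12 = (1 - z ^ 2 / 3) / (4 * z ^ 2) by field_simp; ring,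
    div_le_div_iff₀ (by positivity) (by positivity)]
  nlinarith [sq_nonneg (Real.sinh z * z ^ 2)]

theorem cosh_div_sinh_cube_ge {z : ℝ} (h0 : 0 < z) (h1 : z ≤ 1) :
    1 / (4 * z ^ 3) - z / 24 ≤ Real.cosh z / (4 * Real.sinh z ^ 3) := by
  have hS : 0 < Real.sinh z := Real.sinh_pos_iff.2 h0
  have h := sinh_mul_le_self h0.le h1
  have hC : 1 + z ^ 2 / 2 ≤ Real.cosh z := by
    rw [show z = 2 * (z / 2) by ring, Real.cosh_two_mul, Real.cosh_sq]
    nlinarith [Real.self_le_sinh_iff.2 (by linarith : 0 ≤ z / 2)]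
  have hz2 : z ^ 2 ≤ 1 := by nlinarith
  have hz : 0 < 1 - z ^ 2 / 6 := by linarith
  have h3 : (Real.sinh z * (1 - z ^ 2 / 6)) ^ 3 ≤ z ^ 3 := by gcongr
  rw [show 1 / (4 * z ^ 3) - z / 24 = (1 - z ^ 4 / 6) / (4 * z ^ 3) by field_simp; ring,
    div_le_div_iff₀ (by positivity) (by positivity)]
  have hp : 1 - z ^ 4 / 6 ≤ (1 + z ^ 2 / 2) * (1 - z ^ 2 / 6) ^ 3 := by
    have : 0 ≤ z ^ 6 * (1 / 24 - 1 / 216 - z ^ 2 / 432) :=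
      mul_nonneg (by positivity) (by linarith)
    nlinarith
  calc (1 - z ^ 4 / 6) * (4 * Real.sinh z ^ 3)
      ≤ ((1 + z ^ 2 / 2) * (1 - z ^ 2 / 6) ^ 3) * (4 * Real.sinh z ^ 3) := by gcongr
    _ = (1 + z ^ 2 / 2) * (4 * (Real.sinh z * (1 - z ^ 2 / 6)) ^ 3) := by ring
    _ ≤ Real.cosh z * (4 * z ^ 3) := by gcongr

theorem sinh_quotient_le {z : ℝ} (h0 : 0 < z) :
    (3 + 2 * Real.sinh z ^ 2) / (8 * Real.sinh z ^ 4) ≤ 3 / (8 * z ^ 4) + 1 / (4 * z ^ 2) := by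
  have hS : z ≤ Real.sinh z := Real.self_le_sinh_iff.2 h0.le
  have hS0 : 0 < Real.sinh z := h0.trans_le hS
  calc _ = 3 / (8 * Real.sinh z ^ 4) + 1 / (4 * Real.sinh z ^ 2) := by field_simp; ring
    _ ≤ _ := by gcongr

theorem two_sub_le_exp_neg_mul {y : ℝ} (hy : 0 ≤ y) : 2 - y ≤ Real.exp (-y) * (2 + y) := by
  have hE := Real.add_one_le_exp y
  have h := Real.le_log_one_add_of_nonneg (x := Real.exp y - 1) (by linarith)
  rw [add_sub_cancel, Real.log_exp, div_le_iff₀ (by linarith)] at h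
  rw [Real.exp_neg, inv_mul_eq_div, le_div_iff₀ (Real.exp_pos y)]
  linarith

theorem polynomial_ineq {s w : ℝ} (hs : 25 ≤ s) (h0 : 0 ≤ w) (h1 : w ≤ 13 / 50) :
    6 * s ≤ (2 + s * w ^ 2) * (2 - w) ^ 2 * (3 + s * (1 - w) ^ 2) := by
  obtain ⟨d, rfl⟩ : ∃ d, s = 25 + d := ⟨s - 25, by ring⟩
  have hd : 0 ≤ d := by linarith
  have c0 : 0 ≤ (2 + 25 * w ^ 2) * (2 - w) ^ 2 * (3 + 25 * (1 - w) ^ 2) - 150 := by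
    nlinarith [mul_nonneg h0 (sub_nonneg.2 h1), sq_nonneg (w ^ 2), sq_nonneg (w - 1 / 6),
      sq_nonneg (w * (w - 1 / 6)), sq_nonneg (w ^ 2 * (w - 1 / 6)),
      mul_nonneg (mul_nonneg h0 h0) (sub_nonneg.2 h1)]
  have c1 : 0 ≤ (2 - w) ^ 2 * (3 * w ^ 2 + 2 * (1 - w) ^ 2 + 50 * w ^ 2 * (1 - w) ^ 2) - 6 := by
    nlinarith [mul_nonneg h0 (sub_nonneg.2 h1), sq_nonneg (w ^ 2), sq_nonneg (w - 1 / 15),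
      sq_nonneg (w * (w - 1 / 15)), mul_nonneg (mul_nonneg h0 h0) (sub_nonneg.2 h1)]
  have c2 : 0 ≤ w ^ 2 * (2 - w) ^ 2 * (1 - w) ^ 2 := by positivity
  nlinarith [mul_nonneg hd c1, mul_nonneg (sq_nonneg d) c2]

theorem quadratic_le_exp_div {s u : ℝ} (hs : 25 ≤ s) (h0 : 0 ≤ u) (h1 : u < 1) :
    1 + u - s / 3 * u ^ 2 ≤ Real.exp (-(s * (1 - √(1 - u)) ^ 2)) / (1 - u) := by
  rcases le_total (1 + u - s / 3 * u ^ 2) 0 with h | h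
  · exact h.trans (div_nonneg (Real.exp_pos _).le (by linarith))
  have hu : u < 9 / 20 := by nlinarith
  have hv2 : √(1 - u) ^ 2 = 1 - u := Real.sq_sqrt (by linarith)
  have hv0 : 37 / 50 ≤ √(1 - u) := Real.le_sqrt_of_sq_le (by linarith)
  have hv1 : √(1 - u) ≤ 1 := Real.sqrt_le_one.2 (by linarith)
  generalize √(1 - u) = v at *
  obtain ⟨w, rfl⟩ : ∃ w, v = 1 - w := ⟨1 - v, by ring⟩
  obtain rfl : u = w * (2 - w) := by linarith
  have hw0 : 0 ≤ w := by linarith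
  rw [le_div_iff₀ (by linarith), sub_sub_cancel]
  have hy : 0 ≤ s * w ^ 2 := by positivity
  have hexp := two_sub_le_exp_neg_mul hy
  refine le_of_mul_le_mul_right (hexp.trans' ?_) (by linarith : 0 < 2 + s * w ^ 2)
  have hP := mul_le_mul_of_nonneg_left (polynomial_ineq hs hw0 (by linarith)) (sq_nonneg w)
  linear_combination hP / 3
theorem Nat.Partition.card_le_card_filter_le_count {n k m : ℕ} (hm : 0 < m) (h : k * m ≤ n) :
    Fintype.card (Nat.Partition (n - k * m)) ≤
      (Finset.univ.filter fun p : Nat.Partition n => k ≤ p.parts.count m).card := by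
  classical
  rw [← Finset.card_univ]
  let F : Nat.Partition (n - k * m) → Nat.Partition n := fun p =>
    { parts := p.parts + Multiset.replicate k m
      parts_pos := by
        intro i hi
        rcases Multiset.mem_add.1 hi with hi | hi
        · exact p.parts_pos hi
        · rw [Multiset.eq_of_mem_replicate hi]; exact hm
      parts_sum := by
        rw [Multiset.sum_add, p.parts_sum, Multiset.sum_replicate, smul_eq_mul]
        omega }
  refine Finset.card_le_card_of_injOn F ?_ ?_
  · intro p _
    simp [F]
  · intro p _ q _ hpq
    have := congrArg Nat.Partition.parts hpq
    exact Nat.Partition.ext (add_right_cancel this)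

theorem Nat.Partition.sum_sum_le_mul_card (n : ℕ) :
    ∑ k ∈ Finset.Icc 1 n, ∑ m ∈ Finset.Icc 1 n,
        (if k * m ≤ n then m * Fintype.card (Nat.Partition (n - k * m)) else 0) ≤
      n * Fintype.card (Nat.Partition n) := by
  classical
  calc
    _ ≤ ∑ k ∈ Finset.Icc 1 n, ∑ m ∈ Finset.Icc 1 n, ∑ p : Nat.Partition n,
          (if k ≤ p.parts.count m then m else 0) := by
      refine Finset.sum_le_sum fun k _ => Finset.sum_le_sum fun m hm => ?_
      split_ifs with h
      · rw [← Finset.sum_filter, Finset.sum_const, smul_eq_mul, mul_comm]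
        exact Nat.mul_le_mul_right _
          (card_le_card_filter_le_count (Finset.mem_Icc.1 hm).1 h)
      · exact Nat.zero_le _
    _ = ∑ p : Nat.Partition n, ∑ m ∈ Finset.Icc 1 n, ∑ k ∈ Finset.Icc 1 n,
          (if k ≤ p.parts.count m then m else 0) := by
      rw [Finset.sum_comm]
      simp_rw [Finset.sum_comm (s := Finset.Icc 1 n) (t := Finset.univ)]
    _ ≤ ∑ p : Nat.Partition n, n := by
      refine Finset.sum_le_sum fun p _ => ?_
      have hp : p.parts.toFinset ⊆ Finset.Icc 1 n := fun m hm => by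
        rw [Multiset.mem_toFinset] at hm
        refine Finset.mem_Icc.2 ⟨p.parts_pos hm, ?_⟩
        have := Multiset.le_sum_of_mem hm
        rwa [p.parts_sum] at this
      conv_rhs => rw [← p.parts_sum, Finset.sum_multiset_count_of_subset _ _ hp]
      refine Finset.sum_le_sum fun m _ => ?_
      rw [← Finset.sum_filter, Finset.sum_const, smul_eq_mul, smul_eq_mul]
      refine Nat.mul_le_mul_right _ ?_
      calc _ ≤ (Finset.Icc 1 (p.parts.count m)).card := Finset.card_le_card fun k hk => by
              simp only [Finset.mem_filter, Finset.mem_Icc] at hk ⊢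
              omega
        _ = _ := by simp
    _ = _ := by simp [mul_comm]

theorem Nat.Partition.sum_sigma_mul_card_le (n : ℕ) :
    ∑ t ∈ Finset.Icc 1 n, (∑ d ∈ t.divisors, d) * Fintype.card (Nat.Partition (n - t)) ≤
      n * Fintype.card (Nat.Partition n) := by
  classical
  refine le_trans ?_ (sum_sum_le_mul_card n)
  rw [← Finset.sum_product']
  simp_rw [Finset.sum_mul]
  rw [Finset.sum_sigma', ← Finset.sum_filter]
  refine (Finset.sum_nbij' (fun x => (x.1 / x.2, x.2)) (fun y => ⟨y.1 * y.2, y.2⟩)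
    ?_ ?_ ?_ ?_ ?_).le
  · rintro ⟨t, d⟩ h
    simp only [Finset.mem_sigma, Finset.mem_Icc, Nat.mem_divisors] at h
    obtain ⟨⟨ht, htn⟩, ⟨k, rfl⟩, -⟩ := h
    have hd : 0 < d := Nat.pos_of_mul_pos_right ht
    have hk : 0 < k := Nat.pos_of_mul_pos_left ht
    simp only [Finset.mem_filter, Finset.mem_product, Finset.mem_Icc,
      Nat.mul_div_cancel_left k hd]
    refine ⟨⟨⟨hk, ?_⟩, hd, ?_⟩, ?_⟩ <;> nlinarith
  · rintro ⟨k, m⟩ h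
    simp only [Finset.mem_filter, Finset.mem_product, Finset.mem_Icc] at h
    obtain ⟨⟨⟨hk, -⟩, hm, -⟩, hkm⟩ := h
    simp only [Finset.mem_sigma, Finset.mem_Icc, Nat.mem_divisors]
    exact ⟨⟨Nat.mul_pos hk hm, hkm⟩, Dvd.intro_left k rfl, (Nat.mul_pos hk hm).ne'⟩
  · rintro ⟨t, d⟩ h
    simp only [Finset.mem_sigma, Nat.mem_divisors] at h
    simp [Nat.div_mul_cancel h.2.1]
  · rintro ⟨k, m⟩ h
    simp only [Finset.mem_filter, Finset.mem_product, Finset.mem_Icc] at h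
    simp [Nat.mul_div_cancel k h.1.2.1]
  · rintro ⟨t, d⟩ h
    simp only [Finset.mem_sigma, Nat.mem_divisors] at h
    simp [Nat.div_mul_cancel h.2.1]

def divisorSumUpTo (t : ℕ) : ℕ → ℕ
  | 0 => 0
  | d + 1 => divisorSumUpTo t d + if t % (d + 1) = 0 then d + 1 else 0

def listDot : List ℕ → List ℕ → ℕ
  | a :: A, b :: B => a * b + listDot A B
  | _, _ => 0

/-- `forceNat x k` is `k x`, written so that kernel reduction evaluates `x` to a numeral before
substituting it into `k`. -/
def forceNat (x : ℕ) (k : ℕ → Bool) : Bool :=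
  Nat.rec (k 0) (fun y _ => k (Nat.succ y)) x

theorem forceNat_eq (x : ℕ) (k : ℕ → Bool) : forceNat x k = k x := by
  cases x <;> rfl

def withDivisorSums : ℕ → List ℕ → (List ℕ → Bool) → Bool
  | 0, S, k => k S
  | t + 1, S, k => forceNat (divisorSumUpTo (t + 1) (t + 1)) fun x => withDivisorSums t (x :: S) k

/-- A numerical certificate for `exp (2.5 * √n) < 13 * n * v`, based on `e < 2.7183` and
`2 * b * √n ≤ b ^ 2 + n`. -/
def expSqrtCheck (n b v : ℕ) : Bool :=
  decide (27183 ^ (5 * (b ^ 2 + n)) < (13 * n * v) ^ (4 * b) * 10000 ^ (5 * (b ^ 2 + n)))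

/-- Starting from a list `P` of lower bounds for the partition numbers of `n - 1, …, 0`, check the
exponential bound for the next `f` partition numbers, `S` being the list of divisor sums. -/
def partitionCheck (S : List ℕ) : ℕ → ℕ → ℕ → List ℕ → Bool
  | 0, _, _, _ => true
  | f + 1, n, b, P =>
    forceNat (listDot S P / n) fun v =>
      forceNat (if n ≤ b * b + b then b else b + 1) fun b' =>
        forceNat (n + 1) fun n' => expSqrtCheck n b' v && partitionCheck S f n' b' (v :: P)

theorem partitionCheck_true :
    withDivisorSums 399 [] (fun S => partitionCheck S 399 1 1 [1]) = true := by
  decide +kernel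

theorem divisorSumUpTo_self_le (t : ℕ) : divisorSumUpTo t t ≤ ∑ d ∈ t.divisors, d := by
  have h : ∀ d, divisorSumUpTo t d =
      ∑ e ∈ Finset.range d, if t % (e + 1) = 0 then e + 1 else 0 := by
    intro d
    induction d with
    | zero => rfl
    | succ d ih => rw [Finset.sum_range_succ, ← ih, divisorSumUpTo]
  rw [h, Nat.divisors, Finset.sum_filter, Finset.sum_Ico_eq_sum_range]
  refine Finset.sum_le_sum fun e _ => ?_
  rw [add_comm 1 e]
  simp only [Nat.dvd_iff_mod_eq_zero, le_refl]

theorem listDot_le (a q : ℕ → ℕ) (S P : List ℕ) (hS : ∀ i, S.getD i 0 ≤ a i)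
    (hP : ∀ i, P.getD i 0 ≤ q i) : listDot S P ≤ ∑ i ∈ Finset.range P.length, a i * q i := by
  induction S generalizing P a q with
  | nil => simp [listDot]
  | cons x S ih =>
    cases P with
    | nil => simp [listDot]
    | cons y P =>
      rw [listDot, List.length_cons, Finset.sum_range_succ', add_comm]
      exact Nat.add_le_add
        (ih _ _ P (fun i => by simpa using hS (i + 1)) (fun i => by simpa using hP (i + 1)))
        (Nat.mul_le_mul (by simpa using hS 0) (by simpa using hP 0))

theorem exists_of_withDivisorSums {t : ℕ} {S : List ℕ} {k : List ℕ → Bool}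
    (hS : ∀ i, S.getD i 0 ≤ ∑ d ∈ (t + i + 1).divisors, d) (h : withDivisorSums t S k = true) :
    ∃ S' : List ℕ, (∀ i, S'.getD i 0 ≤ ∑ d ∈ (i + 1).divisors, d) ∧ k S' = true := by
  induction t generalizing S with
  | zero => exact ⟨S, by simpa using hS, h⟩
  | succ t ih =>
    rw [withDivisorSums, forceNat_eq] at h
    refine ih (fun i => ?_) h
    cases i with
    | zero => simpa using divisorSumUpTo_self_le (t + 1)
    | succ i =>
      rw [show t + (i + 1) + 1 = t + 1 + i + 1 by ring]
      simpa using hS i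

theorem exp_sqrt_lt_of_check {n b v : ℕ} (h : expSqrtCheck n b v = true) :
    Real.exp (2.5 * √(n : ℝ)) < 13 * n * v := by
  have h' := of_decide_eq_true h
  have hcast : (27183 : ℝ) ^ (5 * (b ^ 2 + n)) <
      (13 * n * v) ^ (4 * b) * 10000 ^ (5 * (b ^ 2 + n)) := by exact_mod_cast h'
  rw [← div_lt_iff₀ (by positivity), ← div_pow] at hcast
  refine lt_of_pow_lt_pow_left₀ (4 * b) (by positivity) (lt_of_le_of_lt ?_ hcast)
  calc Real.exp (2.5 * √(n : ℝ)) ^ (4 * b)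
      = Real.exp (5 * (2 * b * √(n : ℝ))) := by
        rw [← Real.exp_nat_mul]; push_cast; ring_nf
    _ ≤ Real.exp ((5 * (b ^ 2 + n) : ℕ) * 1) := by
        refine Real.exp_le_exp.2 ?_
        push_cast
        nlinarith [sq_nonneg ((b : ℝ) - √n), Real.sq_sqrt (Nat.cast_nonneg (α := ℝ) n)]
    _ = Real.exp 1 ^ (5 * (b ^ 2 + n)) := Real.exp_nat_mul _ _
    _ ≤ _ := by
        gcongr
        linarith [Real.exp_one_lt_d9]

theorem lt_card_of_partitionCheck {S : List ℕ} (hS : ∀ i, S.getD i 0 ≤ ∑ d ∈ (i + 1).divisors, d)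
    {f n b : ℕ} {P : List ℕ} (hn : 0 < n) (hlen : P.length = n)
    (hP : ∀ i, P.getD i 0 ≤ Fintype.card (Nat.Partition (n - 1 - i)))
    (h : partitionCheck S f n b P = true) {j : ℕ} (hj : n ≤ j) (hjf : j < n + f) :
    Real.exp (2.5 * √(j : ℝ)) / (13 * j) < Fintype.card (Nat.Partition j) := by
  induction f generalizing n b P with
  | zero => omega
  | succ f ih =>
    simp only [partitionCheck, forceNat_eq, Bool.and_eq_true] at h
    obtain ⟨hc, hrec⟩ := h
    have hv : listDot S P / n ≤ Fintype.card (Nat.Partition n) := by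
      refine Nat.div_le_of_le_mul ((listDot_le _ _ S P hS hP).trans ?_)
      refine le_trans (le_of_eq ?_) (Nat.Partition.sum_sigma_mul_card_le n)
      rw [← Finset.Ico_succ_right_eq_Icc, Finset.sum_Ico_eq_sum_range, hlen]
      refine Finset.sum_congr (by simp) fun i _ => ?_
      rw [add_comm 1 i, Nat.sub_sub, add_comm 1 i]
    rcases hj.eq_or_lt with rfl | hj
    · have hpos : (0 : ℝ) < 13 * n := by positivity
      rw [div_lt_iff₀' hpos]
      refine (exp_sqrt_lt_of_check hc).trans_le ?_
      gcongr
    · refine ih (Nat.succ_pos n) (by simp [hlen]) (fun i => ?_) hrec hj (by omega)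
      cases i with
      | zero => simpa using hv
      | succ i =>
        rw [show n + 1 - 1 - (i + 1) = n - 1 - i by omega]
        simpa using hP i

theorem exp_sqrt_div_lt_card_partition_of_lt {n : ℕ} (hn : n < 400) :
    Real.exp (2.5 * √(n : ℝ)) / (13 * n) < Fintype.card (Nat.Partition n) := by
  rcases n.eq_zero_or_pos with rfl | hpos
  · simp
  obtain ⟨S, hS, h⟩ := exists_of_withDivisorSums (fun i => by simp) partitionCheck_true
  refine lt_card_of_partitionCheck hS one_pos rfl (fun i => ?_) h hpos (by omega)
  cases i <;> simp

theorem mul_quadratic_le_exp_sqrt_div {n t : ℕ} (hn : 400 ≤ n) :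
    Real.exp (2.5 * √(n : ℝ)) / (13 * n) * (Real.exp (-(1.25 / √(n : ℝ) * t)) *
        (1 + t / n - 1.25 * √(n : ℝ) / 3 * (t / n) ^ 2)) ≤
      if t ≤ n then Real.exp (2.5 * √((n - t : ℕ) : ℝ)) / (13 * (n - t : ℕ)) else 0 := by
  have hn' : (400 : ℝ) ≤ n := by exact_mod_cast hn
  have hn0 : (0 : ℝ) < n := by linarith
  have hr2 : √(n : ℝ) ^ 2 = n := Real.sq_sqrt hn0.le
  have hr : 20 ≤ √(n : ℝ) := Real.le_sqrt_of_sq_le (by linarith)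
  rcases lt_or_ge t n with h | h
  · have hcast : ((n - t : ℕ) : ℝ) = n * (1 - t / n) := by
      rw [Nat.cast_sub h.le]; field_simp
    have hu1 : (t / n : ℝ) < 1 := by
      rw [div_lt_one hn0]; exact_mod_cast h
    have hu0 : (0 : ℝ) ≤ t / n := by positivity
    have key := quadratic_le_exp_div (s := 1.25 * √(n : ℝ)) (by linarith) hu0 hu1
    have hv2 : √(1 - t / n : ℝ) ^ 2 = 1 - t / n := Real.sq_sqrt (by linarith)
    have ht : (t : ℝ) = √(n : ℝ) ^ 2 * (t / n) := by rw [hr2]; field_simp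
    rw [if_pos h.le, hcast, Real.sqrt_mul hn0.le]
    have hexp : Real.exp (2.5 * (√(n : ℝ) * √(1 - t / n : ℝ))) =
        Real.exp (2.5 * √(n : ℝ)) * (Real.exp (-(1.25 / √(n : ℝ) * t)) *
          Real.exp (-(1.25 * √(n : ℝ) * (1 - √(1 - t / n : ℝ)) ^ 2))) := by
      rw [← Real.exp_add, ← Real.exp_add]
      congr 1
      have : 1.25 / √(n : ℝ) * t = 1.25 * √(n : ℝ) * (t / n) := by
        rw [div_mul_eq_mul_div, div_eq_iff (by linarith)]
        linear_combination 1.25 * ht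
      rw [this]
      linear_combination (1.25 * √(n : ℝ)) * hv2
    rw [hexp]
    calc _ ≤ Real.exp (2.5 * √(n : ℝ)) / (13 * n) * (Real.exp (-(1.25 / √(n : ℝ) * t)) *
          (Real.exp (-(1.25 * √(n : ℝ) * (1 - √(1 - t / n : ℝ)) ^ 2)) / (1 - t / n))) := by
          gcongr
      _ = _ := by
          have : (1 - t / n : ℝ) ≠ 0 := by linarith
          generalize (1 - t / n : ℝ) = x at *
          field_simp
  · have hu : (1 : ℝ) ≤ t / n := by
      rw [one_le_div hn0]; exact_mod_cast h
    refine le_trans (b := 0) ?_ ?_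
    · refine mul_nonpos_of_nonneg_of_nonpos (by positivity)
        (mul_nonpos_of_nonneg_of_nonpos (Real.exp_pos _).le ?_)
      nlinarith
    · split_ifs <;> positivity

theorem hasSum_mul_exp_mul_quadratic {z : ℝ} (hz : 0 < z) (a b : ℝ) :
    HasSum (fun m : ℕ => (m : ℝ) * (Real.exp (-(2 * z * m)) * (1 + a * m - b * m ^ 2)))
      (1 / (4 * Real.sinh z ^ 2) + a * (Real.cosh z / (4 * Real.sinh z ^ 3)) -
        b * ((3 + 2 * Real.sinh z ^ 2) / (8 * Real.sinh z ^ 4))) := by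
  obtain ⟨e1, e2, e3⟩ := exp_neg_eq_sinh_quotients hz
  have h0 := (Real.exp_pos (-(2 * z))).le
  have h1 : Real.exp (-(2 * z)) < 1 := Real.exp_lt_one_iff.2 (by linarith)
  rw [← e1, ← e2, ← e3]
  convert! (((hasSum_coe_mul_geometric_of_norm_lt_one (by rwa [Real.norm_of_nonneg h0])).add
    ((hasSum_sq_mul_geometric h0 h1).mul_left a)).sub
      ((hasSum_cube_mul_geometric h0 h1).mul_left b)) using 1
  funext m
  rw [show -(2 * z * m) = m * -(2 * z) by ring, Real.exp_nat_mul]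
  ring

theorem sum_mul_exp_sqrt_div_ge {n k : ℕ} (hn : 400 ≤ n) (hk : 1 ≤ k) (hk' : k ≤ 15) :
    Real.exp (2.5 * √(n : ℝ)) / (13 * n) * (0.64 * n / k ^ 2 - 1 / 10) ≤
      ∑ m ∈ Finset.Icc 1 n, if k * m ≤ n then
        (m : ℝ) * (Real.exp (2.5 * √((n - k * m : ℕ) : ℝ)) / (13 * (n - k * m : ℕ))) else 0 := by
  have hn' : (400 : ℝ) ≤ n := by exact_mod_cast hn
  have hn0 : (0 : ℝ) < n := by linarith
  have hr2 : √(n : ℝ) ^ 2 = n := Real.sq_sqrt hn0.le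
  have hr : 20 ≤ √(n : ℝ) := Real.le_sqrt_of_sq_le (by linarith)
  have hk1 : (1 : ℝ) ≤ k := by exact_mod_cast hk
  have hk15 : (k : ℝ) ≤ 15 := by exact_mod_cast hk'
  have hterm : ∀ m : ℕ, Real.exp (2.5 * √(n : ℝ)) / (13 * n) *
      ((m : ℝ) * (Real.exp (-(2 * (0.625 * k / √(n : ℝ)) * m)) *
        (1 + k / n * m - 1.25 * √(n : ℝ) / 3 * (k / n) ^ 2 * m ^ 2))) ≤
      if k * m ≤ n then
        (m : ℝ) * (Real.exp (2.5 * √((n - k * m : ℕ) : ℝ)) / (13 * (n - k * m : ℕ))) else 0 := by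
    intro m
    have h := mul_le_mul_of_nonneg_left (mul_quadratic_le_exp_sqrt_div (t := k * m) hn)
      (Nat.cast_nonneg (α := ℝ) m)
    rw [mul_ite, mul_zero] at h
    refine le_of_eq_of_le ?_ h
    push_cast
    rw [show 2 * (0.625 * k / √(n : ℝ)) * m = 1.25 / √(n : ℝ) * (k * m) by ring]
    ring
  refine le_trans ?_ (Finset.sum_le_sum fun m _ => hterm m)
  rw [← Finset.mul_sum]
  refine mul_le_mul_of_nonneg_left ?_ (by positivity)
  have hz0 : 0 < 0.625 * k / √(n : ℝ) := by positivity
  have hz1 : 0.625 * k / √(n : ℝ) ≤ 1 := by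
    rw [div_le_one (by linarith)]; linarith
  have hsum := (hasSum_mul_exp_mul_quadratic hz0 (k / n)
    (1.25 * √(n : ℝ) / 3 * (k / n) ^ 2)).neg
  have hle := sum_le_hasSum (Finset.Icc 1 n) (fun m hm => ?_) hsum
  · rw [Finset.sum_neg_distrib, neg_le_neg_iff] at hle
    refine le_trans ?_ hle
    have b1 := one_div_four_mul_sinh_sq_ge hz0 hz1
    have b2 := mul_le_mul_of_nonneg_left (cosh_div_sinh_cube_ge hz0 hz1)
      (by positivity : (0 : ℝ) ≤ k / n)
    have b3 := mul_le_mul_of_nonneg_left (sinh_quotient_le hz0)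
      (by positivity : 0 ≤ 1.25 * √(n : ℝ) / 3 * ((k : ℝ) / n) ^ 2)
    refine le_trans ?_ (sub_le_sub (add_le_add b1 b2) b3)
    generalize √(n : ℝ) = r at *
    rw [← hr2]
    have e : 1 / (4 * (0.625 * k / r) ^ 2) - 1 / 12 +
        k / r ^ 2 * (1 / (4 * (0.625 * k / r) ^ 3) - 0.625 * k / r / 24) -
        1.25 * r / 3 * (k / r ^ 2) ^ 2 *
          (3 / (8 * (0.625 * k / r) ^ 4) + 1 / (4 * (0.625 * k / r) ^ 2)) =
        0.64 * r ^ 2 / k ^ 2 - 1 / 12 - 0.625 / 24 * k ^ 2 / r ^ 3 - 0.8 / (3 * r) := by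
      field_simp
      ring
    rw [e]
    have e1 : 0.625 / 24 * (k : ℝ) ^ 2 / r ^ 3 ≤ 0.625 / 24 * 15 ^ 2 / 20 ^ 3 := by gcongr
    have e2 : 0.8 / (3 * r) ≤ 0.8 / (3 * 20) := by gcongr
    norm_num at e1 e2 ⊢
    linarith
  · rw [neg_nonneg]
    rcases m.eq_zero_or_pos with rfl | hm0
    · simp
    have hnm : n < m := by
      by_contra! h
      exact hm (Finset.mem_Icc.2 ⟨hm0, h⟩)
    have hkm : ¬ k * m ≤ n := by nlinarith
    have h := hterm m
    rw [if_neg hkm] at h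
    exact nonpos_of_mul_nonpos_right h (by positivity)

theorem exp_sqrt_div_lt_card_partition (n : ℕ) :
    Real.exp (2.5 * √(n : ℝ)) / (13 * n) < Fintype.card (Nat.Partition n) := by
  induction n using Nat.strong_induction_on with
  | _ n ih =>
    rcases lt_or_ge n 400 with hn | hn
    · exact exp_sqrt_div_lt_card_partition_of_lt hn
    have hn' : (400 : ℝ) ≤ n := by exact_mod_cast hn
    have hn0 : (0 : ℝ) < n := by linarith
    have hpos : 0 < Real.exp (2.5 * √(n : ℝ)) / (13 * n) := by positivity
    refine lt_of_mul_lt_mul_left ?_ hn0.le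
    have hrec : ∑ k ∈ Finset.Icc 1 n, ∑ m ∈ Finset.Icc 1 n, (if k * m ≤ n then
        (m : ℝ) * Fintype.card (Nat.Partition (n - k * m)) else 0) ≤
          n * Fintype.card (Nat.Partition n) := by
      exact_mod_cast Nat.Partition.sum_sum_le_mul_card n
    refine lt_of_lt_of_le ?_ hrec
    calc (n : ℝ) * (Real.exp (2.5 * √(n : ℝ)) / (13 * n))
        < ∑ k ∈ Finset.Icc (1 : ℕ) 15,
            Real.exp (2.5 * √(n : ℝ)) / (13 * n) * (0.64 * n / (k : ℝ) ^ 2 - 1 / 10) := by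
          rw [← Finset.mul_sum, mul_comm]
          refine mul_lt_mul_of_pos_left ?_ hpos
          norm_num [Finset.sum_Icc_succ_top]
          linarith
      _ ≤ ∑ k ∈ Finset.Icc 1 15, ∑ m ∈ Finset.Icc 1 n, (if k * m ≤ n then
            (m : ℝ) * (Real.exp (2.5 * √((n - k * m : ℕ) : ℝ)) / (13 * (n - k * m : ℕ)))
              else 0) :=
          Finset.sum_le_sum fun k hk =>
            sum_mul_exp_sqrt_div_ge hn (Finset.mem_Icc.1 hk).1 (Finset.mem_Icc.1 hk).2
      _ ≤ ∑ k ∈ Finset.Icc 1 15, ∑ m ∈ Finset.Icc 1 n, (if k * m ≤ n then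
            (m : ℝ) * Fintype.card (Nat.Partition (n - k * m)) else 0) := by
          refine Finset.sum_le_sum fun k hk => Finset.sum_le_sum fun m hm => ?_
          have hkm : 0 < k * m := Nat.mul_pos (Finset.mem_Icc.1 hk).1 (Finset.mem_Icc.1 hm).1
          split_ifs with h
          · exact mul_le_mul_of_nonneg_left (ih _ (by omega)).le m.cast_nonneg
          · exact le_rfl
      _ ≤ _ := by
          refine Finset.sum_le_sum_of_subset_of_nonneg
            (Finset.Icc_subset_Icc_right (by omega)) fun k _ _ => Finset.sum_nonneg fun m _ => ?_
          split_ifs <;> positivity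

/-- Maróti: for every integer `n₀ > 1`, the total number of partitions of `n₀`
satisfies `p(n₀) > exp(2.5·√n₀) / (13·n₀)`. -/
theorem maroti_partition_lower_bound (n₀ : ℕ) (hn : 1 < n₀) :
    Real.exp (2.5 * Real.sqrt (n₀ : ℝ)) / (13 * (n₀ : ℝ)) <
      (Fintype.card (Nat.Partition n₀) : ℝ) :=
  exp_sqrt_div_lt_card_partition n₀
end

section
/- Let k be a positive integer and let d₋, d be integers with 0 ≤ d₋ ≤ d < k. The number of integer vectors (u_0, u_1, …, u_{k−1}) ∈ Z^k such that exactly d₋ components are negative, the sum of the absolute values of the negative components is at most d, and the sum of the nonnegative components is at most k − 1 − d, equals binom(k, d₋) · binom(d, d₋) · binom(2k − d₋ − d − 1, k − 1 − d). -/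
/-- Prepending a slack variable turns the condition `∑ i, f i ≤ n` into `∑ i, f i = n`. -/
def sumLeEquivSumEqOption (ι : Type*) [Fintype ι] (n : ℕ) :
    {f : ι → ℕ // ∑ i, f i ≤ n} ≃ {P : Option ι → ℕ // ∑ i, P i = n} where
  toFun f := ⟨fun o => o.elim (n - ∑ i, f.1 i) f.1, by
    simpa [Fintype.sum_option] using Nat.sub_add_cancel f.2⟩
  invFun P := ⟨fun i => P.1 (some i), by
    have h := P.2
    rw [Fintype.sum_option] at h
    exact (Nat.le_add_left _ _).trans_eq h⟩
  left_inv f := rfl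
  right_inv P := by
    have h := P.2
    rw [Fintype.sum_option] at h
    ext (_ | i)
    · simp only [Option.elim_none]
      omega
    · rfl

theorem card_sum_le_eq_choose (ι : Type*) [Fintype ι] (n : ℕ) :
    Nat.card {f : ι → ℕ // ∑ i, f i ≤ n} = (n + Fintype.card ι).choose n := by
  classical
  rw [Nat.card_congr ((sumLeEquivSumEqOption ι n).trans (Sym.equivNatSumOfFintype (Option ι) n).symm),
    Nat.card_eq_fintype_card, Sym.card_sym_eq_choose, Fintype.card_option]
  congr 1
  omega

/-- An integer vector with negative support `S` amounts to the vector of the `-u i - 1` for `i ∈ S`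
together with the vector of the `u i` for `i ∉ S`, both with entries in `ℕ`. -/
def signedVectorEquiv {ι : Type*} [Fintype ι] [DecidableEq ι] (S : Finset ι) (m n : ℕ) :
    {u : ι → ℤ // (∀ i, u i < 0 ↔ i ∈ S) ∧ ∑ i ∈ S, |u i| ≤ (S.card + m : ℕ) ∧
      ∑ i ∈ Sᶜ, u i ≤ n} ≃
    {f : {i // i ∈ S} → ℕ // ∑ i, f i ≤ m} × {g : {i // i ∈ Sᶜ} → ℕ // ∑ i, g i ≤ n} where
  toFun u :=
    (⟨fun i => (-u.1 i - 1).toNat, by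
      obtain ⟨u, hu, hm, -⟩ := u
      have h : ∀ i : {i // i ∈ S}, |u i| = ((-u i - 1).toNat : ℤ) + 1 := fun i => by
        have := (hu i).2 i.2
        rw [abs_of_neg this]
        omega
      rw [← Finset.sum_coe_sort, Finset.sum_congr rfl fun i _ => h i, Finset.sum_add_distrib] at hm
      simp only [Finset.sum_const, Finset.card_univ, Fintype.card_coe] at hm
      zify
      push_cast at hm ⊢
      simp only [nsmul_eq_mul, mul_one] at hm
      linarith⟩,
    ⟨fun i => (u.1 i).toNat, by
      obtain ⟨u, hu, -, hn⟩ := u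
      have h : ∀ i : {i // i ∈ Sᶜ}, u i = ((u i).toNat : ℤ) := fun i => by
        have := (hu i).not.2 (Finset.mem_compl.1 i.2)
        omega
      rw [← Finset.sum_coe_sort, Finset.sum_congr rfl fun i _ => h i] at hn
      exact_mod_cast hn⟩)
  invFun p := ⟨fun i => if h : i ∈ S then -(p.1.1 ⟨i, h⟩ : ℤ) - 1
      else p.2.1 ⟨i, Finset.mem_compl.2 h⟩, by
    obtain ⟨⟨f, hf⟩, ⟨g, hg⟩⟩ := p
    refine ⟨fun i => ?_, ?_, ?_⟩
    · by_cases h : i ∈ S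
      · simp only [h, dite_true, iff_true]
        omega
      · simp [h]
    · rw [← Finset.sum_coe_sort]
      have h : ∀ i : {i // i ∈ S}, |-(f i : ℤ) - 1| = f i + 1 := fun i => by
        rw [abs_of_neg (by omega)]
        ring
      simp only [Finset.coe_mem, dite_true, Subtype.coe_eta, h, Finset.sum_add_distrib,
        Finset.sum_const, Finset.card_univ, Fintype.card_coe, nsmul_eq_mul, mul_one]
      zify at hf
      push_cast
      linarith
    · rw [← Finset.sum_coe_sort]
      have h : ∀ i : {i // i ∈ Sᶜ}, (i : ι) ∉ S := fun i => Finset.mem_compl.1 i.2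
      simp only [h, dite_false, Subtype.coe_eta]
      exact_mod_cast hg⟩
  left_inv := by
    rintro ⟨u, hu, -, -⟩
    ext i
    have := hu i
    by_cases h : i ∈ S
    · simp only [h, dite_true, iff_true] at this ⊢
      omega
    · simp only [h, dite_false, iff_false] at this ⊢
      omega
  right_inv := by
    rintro ⟨⟨f, hf⟩, ⟨g, hg⟩⟩
    ext i
    · simp
    · simp [Finset.mem_compl.1 i.2]

theorem card_signed_vectors {ι : Type*} [Fintype ι] [DecidableEq ι] (S : Finset ι) (m n : ℕ) :
    Nat.card {u : ι → ℤ // (∀ i, u i < 0 ↔ i ∈ S) ∧ ∑ i ∈ S, |u i| ≤ (S.card + m : ℕ) ∧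
      ∑ i ∈ Sᶜ, u i ≤ n} =
    (S.card + m).choose S.card * (n + (Fintype.card ι - S.card)).choose n := by
  rw [Nat.card_congr (signedVectorEquiv S m n), Nat.card_prod, card_sum_le_eq_choose,
    card_sum_le_eq_choose, Fintype.card_coe, Fintype.card_coe, Finset.card_compl, add_comm m,
    Nat.choose_symm_add (a := S.card)]

/-- The number of integer vectors `(u_0,…,u_{k−1}) ∈ ℤ^k` with exactly `dm` (= d₋)
negative components, the sum of absolute values of the negative components at
most `d`, and the sum of the nonnegative components at most `k − 1 − d`,
equals `C(k, d₋)·C(d, d₋)·C(2k − d₋ − d − 1, k − 1 − d)`. -/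
theorem card_vectors_eq_choose_product (k dm d : ℕ) (hd : dm ≤ d) (hdk : d < k) :
    {u : Fin k → ℤ |
        (Finset.univ.filter fun i => u i < 0).card = dm ∧
        (∑ i ∈ Finset.univ.filter (fun i => u i < 0), |u i|) ≤ (d : ℤ) ∧
        (∑ i ∈ Finset.univ.filter (fun i => 0 ≤ u i), u i) ≤ (k : ℤ) - 1 - d}.ncard =
      k.choose dm * d.choose dm * (2 * k - dm - d - 1).choose (k - 1 - d) := by
  let A := {u : Fin k → ℤ |
        (Finset.univ.filter fun i => u i < 0).card = dm ∧
        (∑ i ∈ Finset.univ.filter (fun i => u i < 0), |u i|) ≤ (d : ℤ) ∧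
        (∑ i ∈ Finset.univ.filter (fun i => 0 ≤ u i), u i) ≤ (k : ℤ) - 1 - d}
  let negSupport : A → {S : Finset (Fin k) // S.card = dm} :=
    fun u => ⟨Finset.univ.filter fun i => u.1 i < 0, u.2.1⟩
  have fiber_card (S : {S : Finset (Fin k) // S.card = dm}) :
      Nat.card {u : A // negSupport u = S} =
        d.choose dm * (2 * k - dm - d - 1).choose (k - 1 - d) := by
    obtain ⟨S, hS⟩ := S
    have hcount := card_signed_vectors S (d - dm) (k - 1 - d)
    rw [hS, Nat.add_sub_cancel' hd, Fintype.card_fin,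
      show k - 1 - d + (k - dm) = 2 * k - dm - d - 1 by omega] at hcount
    rw [← hcount]
    have hcast : ((k - 1 - d : ℕ) : ℤ) = (k : ℤ) - 1 - d := by omega
    have hnonneg (u : Fin k → ℤ) : Finset.univ.filter (fun i => 0 ≤ u i) =
        (Finset.univ.filter fun i => u i < 0)ᶜ := by
      ext i
      simp
    refine Nat.card_congr ((Equiv.subtypeSubtypeEquivSubtypeExists _ _).trans
      (Equiv.subtypeEquivRight fun u => ?_))
    have hiff : (∀ i, u i < 0 ↔ i ∈ S) ↔ Finset.univ.filter (fun i => u i < 0) = S := by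
      simp [Finset.ext_iff]
    rw [hiff, hcast]
    simp only [negSupport, A, Set.mem_ofPred_eq, Subtype.mk.injEq, hnonneg]
    constructor
    · rintro ⟨⟨-, h₁, h₂⟩, rfl⟩
      exact ⟨rfl, h₁, h₂⟩
    · rintro ⟨rfl, h₁, h₂⟩
      exact ⟨⟨hS, h₁, h₂⟩, rfl⟩
  have (S : {S : Finset (Fin k) // S.card = dm}) : Finite {u : A // negSupport u = S} := by
    apply Nat.finite_of_card_ne_zero
    rw [fiber_card S]
    exact (Nat.mul_pos (Nat.choose_pos hd) (Nat.choose_pos (by omega))).ne'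
  change A.ncard = _
  rw [← Nat.card_coe_set_eq, ← Nat.card_congr (Equiv.sigmaFiberEquiv negSupport), Nat.card_sigma,
    Finset.sum_congr rfl fun S _ => fiber_card S, Finset.sum_const, Finset.card_univ,
    Fintype.card_finset_len, Fintype.card_fin, smul_eq_mul, mul_assoc]
end

section
/- Let p ≥ 5 be a prime, q = p^n, and let k > 1 be a divisor of q − 1, say q − 1 = k·h. Let a ∈ F_q* be such that y^k − a is irreducible over F_q, let η be the image of y in F_q[y]/⟨y^k − a⟩, and let b ∈ F_q*. Let S be the set of integer vectors (u_0, …, u_{k−1}) ∈ Z^k such that the number of negative components is d₋, the sum of absolute values of the negative components is at most d, and the sum of the nonnegative components is at most k − 1 − d, for some fixed 0 ≤ d₋ ≤ d < k. Then the map sending (u_0, …, u_{k−1}) to the product Π_{i=0}^{k−1} (a^{h·i}·η + b)^{u_i} (taken in the multiplicative group of the field F_q[y]/⟨y^k − a⟩) is injective on S. -/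
open Polynomial

/-- In a finite cyclic group of order `s * r`, every element killed by `s` is an `r`-th power. -/
theorem IsCyclic.exists_pow_eq_of_pow_eq_one {G : Type*} [Group G] [Finite G] [IsCyclic G]
    {r s : ℕ} (hG : Nat.card G = s * r) {x : G} (hx : x ^ s = 1) : ∃ y : G, y ^ r = x := by
  obtain ⟨g, hg⟩ := IsCyclic.exists_generator (α := G)
  obtain ⟨t, rfl⟩ := (mem_powers_iff_mem_zpowers.2 (hg x) : ∃ t : ℕ, g ^ t = x)
  have hpos : 0 < s * r := hG ▸ Nat.card_pos
  have hord : orderOf g = s * r := by rw [← hG, orderOf_eq_card_of_forall_mem_zpowers hg]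
  rw [← pow_mul] at hx
  have hdvd := orderOf_dvd_of_pow_eq_one hx
  rw [hord, mul_comm s r] at hdvd
  obtain ⟨w, rfl⟩ := Nat.dvd_of_mul_dvd_mul_right (Nat.pos_of_mul_pos_right hpos) hdvd
  exact ⟨g ^ w, by rw [← pow_mul, mul_comm]⟩

/-- If `X ^ k - a` is irreducible over a finite field with `k * h + 1` elements, then
`1, a ^ h, …, a ^ (h * (k - 1))` are distinct. -/
theorem FiniteField.injective_pow_of_irreducible_X_pow_sub_C {F : Type*} [Field F] [Fintype F]
    {k h : ℕ} (hkh : Fintype.card F - 1 = k * h) {a : F} (ha : a ≠ 0)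
    (hirr : Irreducible (X ^ k - C a)) :
    Function.Injective fun i : Fin k => a ^ (h * (i : ℕ)) := by
  let x : Fˣ := Units.mk0 a ha
  have hcard : Nat.card Fˣ = k * h := by
    rw [Nat.card_units, Nat.card_eq_fintype_card, hkh]
  have hxk : (x ^ h) ^ k = 1 := by
    rw [← pow_mul, mul_comm, ← hcard, pow_card_eq_one']
  obtain ⟨r, hr⟩ := orderOf_dvd_of_pow_eq_one hxk
  have hr1 : r = 1 := by
    by_contra hne
    obtain ⟨y, hy⟩ := IsCyclic.exists_pow_eq_of_pow_eq_one (x := x) (r := r)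
      (s := h * orderOf (x ^ h)) (by rw [hcard, mul_assoc, ← hr, mul_comm])
      (by rw [pow_mul, pow_orderOf_eq_one])
    refine pow_ne_of_irreducible_X_pow_sub_C hirr (Dvd.intro_left _ hr.symm) hne (y : F) ?_
    rw [← Units.val_pow_eq_pow_val, hy]
    rfl
  have hord : orderOf (x ^ h) = k := by rw [hr1, mul_one] at hr; exact hr.symm
  intro i j hij
  refine Fin.ext (pow_injOn_Iio_orderOf (x := x ^ h) ?_ ?_ (Units.ext ?_))
  · simp [hord]
  · simp [hord]
  · simpa [pow_mul, x] using hij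

/-- The exponents in a product of powers of linear polynomials with distinct nonzero leading
coefficients and a common nonzero constant term are determined by the product. -/
theorem Polynomial.prod_C_mul_X_add_C_pow_injective {F ι : Type*} [Field F] [Fintype ι]
    {c : ι → F} (hc : Function.Injective c) (hc0 : ∀ i, c i ≠ 0) {b : F} (hb : b ≠ 0) :
    Function.Injective fun s : ι → ℕ => ∏ i, (C (c i) * X + C b) ^ s i := by
  classical
  have hne : ∀ i, (C (c i) * X + C b : F[X]) ≠ 0 := fun i => by
    intro h0
    simpa [hb] using congrArg (coeff · 0) h0
  have hcount : ∀ (s : ι → ℕ) (j : ι),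
      (∏ i, (C (c i) * X + C b) ^ s i).roots.count (-((c j)⁻¹ * b)) = s j := fun s j => by
    rw [roots_prod _ _ (Finset.prod_ne_zero_iff.2 fun i _ => pow_ne_zero _ (hne i)),
      Multiset.count_bind]
    simp_rw [roots_pow, roots_C_mul_X_add_C b (hc0 _), Multiset.count_nsmul,
      Multiset.count_singleton]
    have : ∀ i, (-((c j)⁻¹ * b) = -((c i)⁻¹ * b)) ↔ j = i := fun i => by
      simp [hb, hc.eq_iff]
    simp [this]
  intro s t hst
  funext j
  rw [← hcount s j, ← hcount t j]
  exact congrArg (fun f : F[X] => f.roots.count _) hst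

/-- Splitting integer exponents into positive and negative parts in an equality of products. -/
theorem Finset.prod_pow_toNat_eq_of_prod_zpow_eq {K ι : Type*} [Field K] {s : Finset ι}
    {x : ι → K} (hx : ∀ i ∈ s, x i ≠ 0) {u v : ι → ℤ}
    (huv : ∏ i ∈ s, x i ^ u i = ∏ i ∈ s, x i ^ v i) :
    ∏ i ∈ s, x i ^ ((u i).toNat + (-v i).toNat) =
      ∏ i ∈ s, x i ^ ((v i).toNat + (-u i).toNat) := by
  have key : ∀ w w' : ι → ℤ, ∏ i ∈ s, x i ^ ((w i).toNat + (-w' i).toNat) =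
      (∏ i ∈ s, x i ^ w i) * ∏ i ∈ s, x i ^ ((-w i).toNat + (-w' i).toNat) := fun w w' => by
    rw [← Finset.prod_mul_distrib]
    refine Finset.prod_congr rfl fun i hi => ?_
    rw [← zpow_natCast, ← zpow_natCast, ← zpow_add₀ (hx i hi)]
    congr 1
    push_cast
    omega
  rw [key u v, key v u, huv]
  simp_rw [add_comm]

theorem Int.sum_toNat_eq_sum_filter_nonneg {ι : Type*} (s : Finset ι) (u : ι → ℤ) :
    ((∑ i ∈ s, (u i).toNat : ℕ) : ℤ) = ∑ i ∈ s with 0 ≤ u i, u i := by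
  rw [Finset.sum_filter, Nat.cast_sum]
  exact Finset.sum_congr rfl fun i _ => by split_ifs <;> omega

theorem Int.sum_toNat_neg_eq_sum_filter_abs {ι : Type*} (s : Finset ι) (u : ι → ℤ) :
    ((∑ i ∈ s, (-u i).toNat : ℕ) : ℤ) = ∑ i ∈ s with u i < 0, |u i| := by
  rw [Finset.sum_filter, Nat.cast_sum]
  exact Finset.sum_congr rfl fun i _ => by
    split_ifs with hi
    · rw [abs_of_neg hi]; omega
    · omega

theorem Polynomial.natDegree_prod_C_mul_X_add_C_pow_le {R ι : Type*} [CommSemiring R]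
    (s : Finset ι) (c : ι → R) (b : R) (e : ι → ℕ) :
    (∏ i ∈ s, (C (c i) * X + C b) ^ e i).natDegree ≤ ∑ i ∈ s, e i := by
  refine (natDegree_prod_le _ _).trans (Finset.sum_le_sum fun i _ => ?_)
  simpa using natDegree_pow_le_of_le (e i) (natDegree_linear_le (a := c i) (b := b))

/-- Polynomials of degree less than that of `f` are determined by their class modulo `f`. -/
theorem AdjoinRoot.mk_injOn_degree_lt {F : Type*} [Field F] {f : F[X]} :
    Set.InjOn (AdjoinRoot.mk f) {g | g.degree < f.degree} := by
  intro g hg g' hg' hgg'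
  exact sub_eq_zero.1 <| eq_zero_of_dvd_of_degree_lt (AdjoinRoot.mk_eq_mk.1 hgg')
    ((degree_sub_le _ _).trans_lt (max_lt hg hg'))

/-- Key step in the proof of Theorem 1: distinct vectors in `S` yield distinct
products `Π_{i<k} (a^{h·i}·η + b)^{u_i}` in the field `F_q[y]/⟨y^k − a⟩`. -/
theorem injOn_product_S
    (p n q k h : ℕ) (hp : p.Prime) (hp5 : 5 ≤ p) (hn : 0 < n) (hq : q = p ^ n)
    (hk : 1 < k) (hkh : q - 1 = k * h)
    (F : Type*) [Field F] [Fintype F] (hcard : Fintype.card F = q)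
    (a : F) (ha : a ≠ 0) [hirr : Fact (Irreducible (X ^ k - C a))]
    (b : F) (hb : b ≠ 0) (dm d : ℕ) (hd : dm ≤ d) (hdk : d < k) :
    Set.InjOn
      (fun u : Fin k → ℤ => ∏ i : Fin k,
        (AdjoinRoot.of (X ^ k - C a) (a ^ (h * (i : ℕ))) *
            AdjoinRoot.root (X ^ k - C a) +
          AdjoinRoot.of (X ^ k - C a) b) ^ (u i))
      {u : Fin k → ℤ |
        (Finset.univ.filter fun i => u i < 0).card = dm ∧
        (∑ i ∈ Finset.univ.filter (fun i => u i < 0), |u i|) ≤ (d : ℤ) ∧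
        (∑ i ∈ Finset.univ.filter (fun i => 0 ≤ u i), u i) ≤ (k : ℤ) - 1 - d} := by
  have hk0 : 0 < k := by omega
  set f : F[X] := X ^ k - C a
  set c : Fin k → F := fun i => a ^ (h * (i : ℕ))
  have hcinj : Function.Injective c :=
    FiniteField.injective_pow_of_irreducible_X_pow_sub_C (by rw [hcard, hkh]) ha hirr.out
  have hdegf : f.degree = k := degree_X_pow_sub_C hk0 a
  have hdeg : ∀ g : F[X], g.natDegree < k → g ∈ {g : F[X] | g.degree < f.degree} :=
    fun g hg => by
      rw [Set.mem_ofPred_eq, hdegf]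
      exact degree_le_natDegree.trans_lt (by exact_mod_cast hg)
  have hmk : ∀ i, AdjoinRoot.of f (c i) * AdjoinRoot.root f + AdjoinRoot.of f b =
      AdjoinRoot.mk f (C (c i) * X + C b) := fun i => by simp
  have hne : ∀ i ∈ Finset.univ, AdjoinRoot.mk f (C (c i) * X + C b) ≠ 0 := fun i _ h0 => by
    have := AdjoinRoot.mk_injOn_degree_lt (hdeg _ (natDegree_linear_le.trans_lt hk))
      (hdeg 0 (by simpa using hk0)) (h0.trans (map_zero _).symm)
    simpa [hb] using congrArg (coeff · 0) this
  rintro u ⟨-, hu1, hu2⟩ v ⟨-, hv1, hv2⟩ huv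
  change ∏ i, (AdjoinRoot.of f (c i) * AdjoinRoot.root f + AdjoinRoot.of f b) ^ u i =
    ∏ i, (AdjoinRoot.of f (c i) * AdjoinRoot.root f + AdjoinRoot.of f b) ^ v i at huv
  simp_rw [hmk] at huv
  have hprod := Finset.prod_pow_toNat_eq_of_prod_zpow_eq hne huv
  simp_rw [← map_pow, ← map_prod] at hprod
  rw [← Int.sum_toNat_neg_eq_sum_filter_abs] at hu1 hv1
  rw [← Int.sum_toNat_eq_sum_filter_nonneg] at hu2 hv2
  have hexp := Polynomial.prod_C_mul_X_add_C_pow_injective hcinj (fun i => pow_ne_zero _ ha) hb <|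
    AdjoinRoot.mk_injOn_degree_lt
      (hdeg _ ((natDegree_prod_C_mul_X_add_C_pow_le _ _ _ _).trans_lt
        (by rw [Finset.sum_add_distrib]; omega)))
      (hdeg _ ((natDegree_prod_C_mul_X_add_C_pow_le _ _ _ _).trans_lt
        (by rw [Finset.sum_add_distrib]; omega))) hprod
  funext i
  have := congrFun hexp i
  omega
end

section
/- Let p ≥ 5 be a prime, q = p^n, and let m = k·l with k > 1 a divisor of q − 1 and l ≥ 1 equal to the multiplicative order of q modulo m. Let a ∈ F_q* be such that x^m − a is irreducible over F_q, let θ be the image of x in F_q[x]/⟨x^m − a⟩, and let b ∈ F_q*. For each i ∈ {0, …, l − 1}, let z_i ∈ {0, …, l−1} and j_i ∈ Z be such that q^{z_i} = (i·k + 1) + j_i·m. Let T = {(u_0, …, u_{l−1}) ∈ Z^l : Σ_{i=0}^{l−1} (i·k + 1)u_i < m and 0 ≤ u_0, …, u_{l−1} ≤ p − 1}. Then the map sending (u_0, …, u_{l−1}) ∈ T to the product Π_{i=0}^{l−1} (a^{j_i}·θ^{i·k+1} + b)^{u_i} in F_q[x]/⟨x^m − a⟩ is injective on T. -/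
open Polynomial

/-- Modulo `X ^ (e + 1)`, a power of `c X ^ e + b` is its first-order binomial expansion. -/
theorem X_pow_succ_dvd_pow_sub {R : Type*} [CommRing R] (c b : R) {e : ℕ} (he : 0 < e) (u : ℕ) :
    X ^ (e + 1) ∣ (C c * X ^ e + C b) ^ u -
      (C (b ^ u) + C (u * b ^ (u - 1) * c) * X ^ e) := by
  obtain ⟨w, hw⟩ := Polynomial.powAddExpansion (C b) (C c * X ^ e) u
  have h : (X : R[X]) ^ (e + 1) ∣ X ^ (e * 2) := pow_dvd_pow _ (by omega)
  rw [add_comm (C c * X ^ e), hw]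
  convert (h.mul_left (w * C c ^ 2)) using 1
  simp only [C_mul, C_pow, map_natCast]
  ring

/-- Modulo `X ^ N`, a product of powers of `c i X ^ e i + b` with all `e i ≥ N` is constant. -/
theorem X_pow_dvd_prod_sub {R ι : Type*} [CommRing R] (s : Finset ι) (c : ι → R) (b : R)
    (e u : ι → ℕ) {N : ℕ} (h : ∀ i ∈ s, N ≤ e i) :
    X ^ N ∣ (∏ i ∈ s, (C (c i) * X ^ e i + C b) ^ u i) - C (∏ i ∈ s, b ^ u i) := by
  rw [← Ideal.mem_span_singleton, ← Ideal.Quotient.mk_eq_mk_iff_sub_mem]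
  simp only [map_prod, map_pow]
  refine Finset.prod_congr rfl fun i hi ↦ ?_
  rw [← map_pow, ← map_pow, ← map_pow, Ideal.Quotient.mk_eq_mk_iff_sub_mem,
    Ideal.mem_span_singleton, map_pow]
  refine dvd_trans ?_ (sub_dvd_pow_sub_pow _ _ _)
  rw [add_sub_cancel_right]
  exact (pow_dvd_pow _ (h i hi)).mul_left _

/-- The constant and `e i₀`-th coefficients of a product of powers of `c i X ^ e i + b`, when
`e i₀` is the smallest exponent. -/
theorem coeff_mul_prod_pow {F ι : Type*} [Field F] (s : Finset ι) (c : ι → F) {b : F}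
    (hb : b ≠ 0) (e u : ι → ℕ) (i₀ : ι) (he : 0 < e i₀) (h : ∀ i ∈ s, e i₀ < e i) :
    ∃ r : F, r ≠ 0 ∧
      ((C (c i₀) * X ^ e i₀ + C b) ^ u i₀ *
        ∏ i ∈ s, (C (c i) * X ^ e i + C b) ^ u i).coeff 0 = r ∧
      ((C (c i₀) * X ^ e i₀ + C b) ^ u i₀ *
        ∏ i ∈ s, (C (c i) * X ^ e i + C b) ^ u i).coeff (e i₀) = u i₀ * (c i₀ / b * r) := by
  obtain ⟨f, hf⟩ := X_pow_succ_dvd_pow_sub (c i₀) b he (u i₀)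
  obtain ⟨g, hg⟩ := X_pow_dvd_prod_sub s c b e u h
  set t := ∏ i ∈ s, b ^ u i with ht
  have ht0 : t ≠ 0 := Finset.prod_ne_zero_iff.mpr fun i _ ↦ pow_ne_zero _ hb
  have hpow : (u i₀ : F) * b ^ (u i₀ - 1) = u i₀ * (b ^ u i₀ / b) := by
    rcases Nat.eq_zero_or_pos (u i₀) with h0 | h0
    · simp [h0]
    · rw [pow_sub₀ _ hb h0, pow_one, div_eq_mul_inv]
  have key : ∃ w : F[X], (C (c i₀) * X ^ e i₀ + C b) ^ u i₀ *
      ∏ i ∈ s, (C (c i) * X ^ e i + C b) ^ u i =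
      C (b ^ u i₀ * t) + C (u i₀ * b ^ (u i₀ - 1) * c i₀ * t) * X ^ e i₀ +
        w * X ^ (e i₀ + 1) := by
    rw [eq_add_of_sub_eq hf, eq_add_of_sub_eq hg]
    refine ⟨f * (X ^ (e i₀ + 1) * g + C t) +
      (C (b ^ u i₀) + C (u i₀ * b ^ (u i₀ - 1) * c i₀) * X ^ e i₀) * g, ?_⟩
    simp only [C_mul, Nat.succ_eq_add_one]
    ring
  obtain ⟨w, hw⟩ := key
  refine ⟨b ^ u i₀ * t, mul_ne_zero (pow_ne_zero _ hb) ht0, ?_, ?_⟩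
  · rw [hw]
    generalize b ^ u i₀ * t = r
    simp [he.ne]
  · rw [hw, hpow]
    simp only [coeff_add, coeff_mul_X_pow', coeff_C, he.ne', if_false]
    simp
    field_simp

/-- Exponents of a product of powers of `c i X ^ e i + b` are determined by the product. -/
theorem eq_of_prod_pow_eq {F ι : Type*} [Field F] [Fintype ι] [LinearOrder ι] {p : ℕ} [CharP F p]
    {c : ι → F} (hc : ∀ i, c i ≠ 0) {b : F} (hb : b ≠ 0) {e : ι → ℕ} (he : StrictMono e)
    (he0 : ∀ i, 0 < e i) {u v : ι → ℕ} (hu : ∀ i, u i < p) (hv : ∀ i, v i < p)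
    (h : ∏ i, (C (c i) * X ^ e i + C b) ^ u i = ∏ i, (C (c i) * X ^ e i + C b) ^ v i) :
    u = v := by
  funext i
  induction i using WellFoundedLT.induction with
  | ind i ih =>
  have hA : ∀ j, (C (c j) * X ^ e j + C b : F[X]) ≠ 0 := fun j hj ↦ by
    have := congrArg (fun f ↦ coeff f 0) hj
    simp [coeff_X_pow, (he0 j).ne, hb] at this
  have split : ∀ w : ι → ℕ, ∏ j, (C (c j) * X ^ e j + C b) ^ w j =
      (∏ j with j < i, (C (c j) * X ^ e j + C b) ^ w j) *
        ((C (c i) * X ^ e i + C b) ^ w i *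
          ∏ j with i < j, (C (c j) * X ^ e j + C b) ^ w j) := fun w ↦ by
    rw [← Finset.prod_filter_mul_prod_filter_not Finset.univ (· < i)]
    congr 1
    rw [← Finset.prod_insert (f := fun j ↦ (C (c j) * X ^ e j + C b) ^ w j) (by simp)]
    refine Finset.prod_congr ?_ fun _ _ ↦ rfl
    ext j
    simp [le_iff_eq_or_lt, eq_comm]
  rw [split u, split v, Finset.prod_congr rfl fun j hj ↦ by
    rw [ih j (Finset.mem_filter.mp hj).2]] at h
  replace h := mul_left_cancel₀ (Finset.prod_ne_zero_iff.mpr fun j _ ↦ pow_ne_zero _ (hA j)) h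
  have hs : ∀ j ∈ Finset.univ.filter (i < ·), e i < e j := fun j hj ↦
    he (Finset.mem_filter.mp hj).2
  obtain ⟨r, hr, hu0, hu1⟩ := coeff_mul_prod_pow _ c hb e u i (he0 i) hs
  obtain ⟨r', -, hv0, hv1⟩ := coeff_mul_prod_pow _ c hb e v i (he0 i) hs
  rw [h] at hu0 hu1
  obtain rfl : r = r' := hu0.symm.trans hv0
  have := mul_right_cancel₀ (mul_ne_zero (div_ne_zero (hc i) hb) hr) (hu1.symm.trans hv1)
  exact CharP.natCast_injOn_Iio F p (hu i) (hv i) this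

/-- The degree of a product of powers of `c i X ^ e i + b`. -/
theorem natDegree_prod_pow_le {R ι : Type*} [CommRing R] [Fintype ι] (c : ι → R) (b : R)
    (e u : ι → ℕ) :
    (∏ i, (C (c i) * X ^ e i + C b) ^ u i).natDegree ≤ ∑ i, e i * u i := by
  have h (i : ι) : ((C (c i) * X ^ e i + C b) ^ u i).natDegree ≤ e i * u i := by
    rw [mul_comm (e i)]
    refine natDegree_pow_le.trans (Nat.mul_le_mul_left (u i) ?_)
    rw [natDegree_add_C]
    exact natDegree_C_mul_X_pow_le _ _
  exact (natDegree_prod_le Finset.univ fun i ↦ (C (c i) * X ^ e i + C b) ^ u i).trans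
    (Finset.sum_le_sum fun i _ ↦ h i)

/-- Key step in the proof of Theorem 2: distinct vectors in `T` yield distinct
products `Π_{i<l} (a^{j_i}·θ^{i·k+1} + b)^{u_i}` in the field `F_q[x]/⟨x^m − a⟩`,
where `q^{z_i} = (i·k + 1) + j_i·m` with `0 ≤ z_i ≤ l − 1`. -/
theorem injOn_product_T
    (p n q m k l : ℕ) (hp : p.Prime) (hp5 : 5 ≤ p) (hn : 0 < n) (hq : q = p ^ n)
    (hk : 1 < k) (hkdvd : k ∣ q - 1) (hm : m = k * l) (hl : 1 ≤ l)
    (hord : orderOf (q : ZMod m) = l)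
    (F : Type*) [Field F] [Fintype F] (hcard : Fintype.card F = q)
    (a : F) (ha : a ≠ 0) (hirr : Irreducible (X ^ m - C a))
    (b : F) (hb : b ≠ 0)
    (z : Fin l → Fin l) (j : Fin l → ℤ)
    (hzj : ∀ i : Fin l, (q : ℤ) ^ ((z i : ℕ)) = ((i : ℕ) * k + 1 : ℤ) + j i * m) :
    Set.InjOn
      (fun u : Fin l → ℕ => ∏ i : Fin l,
        (AdjoinRoot.of (X ^ m - C a) (a ^ (j i)) *
            (AdjoinRoot.root (X ^ m - C a)) ^ ((i : ℕ) * k + 1) +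
          AdjoinRoot.of (X ^ m - C a) b) ^ (u i))
      {u : Fin l → ℕ | (∀ i, u i ≤ p - 1) ∧
        ∑ i : Fin l, ((i : ℕ) * k + 1) * u i < m} := by
  intro u hu v hv h
  have hp1 : p - 1 < p := Nat.sub_lt hp.pos one_pos
  have : Fact p.Prime := ⟨hp⟩
  have : CharP F p := charP_of_card_eq_prime_pow (by rw [hcard, hq])
  have hm0 : m ≠ 0 := by
    rw [hm]
    exact mul_ne_zero (by omega) (by omega)
  have hmk : ∀ w : Fin l → ℕ, ∏ i : Fin l,
        (AdjoinRoot.of (X ^ m - C a) (a ^ (j i)) *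
            (AdjoinRoot.root (X ^ m - C a)) ^ ((i : ℕ) * k + 1) +
          AdjoinRoot.of (X ^ m - C a) b) ^ (w i) =
      AdjoinRoot.mk (X ^ m - C a)
        (∏ i, (C (a ^ j i) * X ^ ((i : ℕ) * k + 1) + C b) ^ w i) := fun w ↦ by
    simp only [map_prod, map_pow, map_add, map_mul, AdjoinRoot.mk_C, AdjoinRoot.mk_X]
  simp only [hmk] at h
  refine eq_of_prod_pow_eq (p := p) (c := fun i ↦ a ^ j i) (b := b)
    (e := fun i : Fin l ↦ (i : ℕ) * k + 1) (fun i ↦ zpow_ne_zero _ ha) hb ?_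
    (fun i ↦ Nat.succ_pos _) (fun i ↦ (hu.1 i).trans_lt hp1) (fun i ↦ (hv.1 i).trans_lt hp1) ?_
  · intro i i' hi
    exact Nat.succ_lt_succ (Nat.mul_lt_mul_of_pos_right hi (by omega))
  · refine sub_eq_zero.mp (eq_zero_of_dvd_of_natDegree_lt (AdjoinRoot.mk_eq_mk.mp h) ?_)
    rw [natDegree_X_pow_sub_C]
    exact (natDegree_sub_le _ _).trans_lt (max_lt
      ((natDegree_prod_pow_le _ _ _ _).trans_lt hu.2)
      ((natDegree_prod_pow_le _ _ _ _).trans_lt hv.2))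
end

section
/- Let p ≥ 5 be a prime, k > 1 and l ≥ 2 integers, and m = k·l. Let T be the set of integer vectors (u_0, …, u_{l−1}) such that 0 ≤ u_i ≤ p − 1 for all i and Σ_{i=0}^{l−1} (i·k + 1)·u_i < m. Then |T| is at least the number of partitions of l − 1 in which every part appears at most p − 1 times. -/
/-- For `n < l`, the parts of size `1, …, l` of a partition of `n`, weighted by their
multiplicities, sum to `n`. -/
theorem Nat.Partition.sum_succ_mul_count {n l : ℕ} (P : n.Partition) (h : n < l) :
    ∑ i : Fin l, ((i : ℕ) + 1) * P.parts.count ((i : ℕ) + 1) = n := by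
  have hsub : P.parts.toFinset ⊆ Finset.range (l + 1) := fun j hj => by
    have := P.le_of_mem_parts (Multiset.mem_toFinset.mp hj)
    exact Finset.mem_range.mpr (by omega)
  calc ∑ i : Fin l, ((i : ℕ) + 1) * P.parts.count ((i : ℕ) + 1)
      = ∑ j ∈ Finset.range (l + 1), j * P.parts.count j := by
        rw [Finset.sum_range_succ', Fin.sum_univ_eq_sum_range
          (fun i => (i + 1) * P.parts.count (i + 1)), Nat.zero_mul, Nat.add_zero]
    _ = ∑ j ∈ P.parts.toFinset, P.parts.count j • j := by
        refine (Finset.sum_subset hsub fun j _ hj => ?_).symm.trans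
          (Finset.sum_congr rfl fun j _ => by rw [smul_eq_mul, Nat.mul_comm])
        rw [Multiset.count_eq_zero_of_notMem (mt Multiset.mem_toFinset.mpr hj), Nat.mul_zero]
    _ = n := by rw [← Finset.sum_multiset_count, P.parts_sum]

/-- A partition of `n` is determined by the multiplicities of the parts `1, …, l` for `n < l`. -/
theorem Nat.Partition.count_succ_injective {n l : ℕ} (h : n < l) :
    Function.Injective
      (fun (P : n.Partition) (i : Fin l) => P.parts.count ((i : ℕ) + 1)) := by
  intro P Q hPQ
  refine Nat.Partition.ext (Multiset.ext.mpr fun j => ?_)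
  have vanish (R : n.Partition) (hj : j = 0 ∨ l < j) : R.parts.count j = 0 :=
    Multiset.count_eq_zero_of_notMem fun hmem => by
      have := R.parts_pos hmem
      have := R.le_of_mem_parts hmem
      omega
  by_cases hj : j = 0 ∨ l < j
  · rw [vanish P hj, vanish Q hj]
  · obtain ⟨i, rfl⟩ : ∃ i, j = i + 1 := ⟨j - 1, by omega⟩
    exact congrFun hPQ ⟨i, by omega⟩

/-- Step in the proof of item (i) of Theorem 2: with `m = k·l`, the cardinality of
`T = {(u_0,…,u_{l−1}) ∈ ℤ^l : Σ (i·k+1)·u_i < m, 0 ≤ u_i ≤ p−1}` is at least the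
number of partitions of `l − 1` in which every part appears at most `p − 1` times. -/
theorem card_T_ge_partitions (p k l : ℕ) (hp : p.Prime) (hp5 : 5 ≤ p)
    (hk : 1 < k) (hl : 2 ≤ l) :
    {P : Nat.Partition (l - 1) | ∀ j : ℕ, P.parts.count j ≤ p - 1}.ncard ≤
      {u : Fin l → ℕ | (∀ i, u i ≤ p - 1) ∧
        ∑ i : Fin l, ((i : ℕ) * k + 1) * u i < k * l}.ncard := by
  -- A part `j` is sent to the index `j - 1`, whose weight `(j - 1) * k + 1` is at most `j * k`.
  refine Set.ncard_le_ncard_of_injOn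
    (fun P (i : Fin l) => P.parts.count ((i : ℕ) + 1)) ?_
    (Nat.Partition.count_succ_injective (by omega)).injOn
    ((Set.finite_Iic fun _ : Fin l => p - 1).subset fun u hu => hu.1)
  refine fun P hP => ⟨fun i => hP _, ?_⟩
  calc ∑ i : Fin l, ((i : ℕ) * k + 1) * P.parts.count ((i : ℕ) + 1)
      ≤ ∑ i : Fin l, k * (((i : ℕ) + 1) * P.parts.count ((i : ℕ) + 1)) := by
        refine Finset.sum_le_sum fun i _ => ?_
        rw [← Nat.mul_assoc]
        exact Nat.mul_le_mul_right _ (by linarith)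
    _ = k * (l - 1) := by rw [← Finset.mul_sum, P.sum_succ_mul_count (by omega)]
    _ < k * l := Nat.mul_lt_mul_of_pos_left (by omega) (by omega)
end
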